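/- Let k ≥ 3, let a ≠ b be alternatives, and let f : S_k → [k] be an SCF on one voter. Suppose σ ∈ ∂(B). Then either σ ∈ LD(a,b), or there exist an alternative c ∉ {a,b} and a 3-manipulation point σ̂ ∈ M_3(f) such that σ̂ is obtained from σ or from [a:b]σ by moving alternative c to some (possibly different) position while keeping the relative order of all other alternatives unchanged. -/

import Mathlib

open Finset

/-- `a` is ranked above `b` in the ranking `τ` (a ranking maps positions to
alternatives; earlier positions are better). -/
def Above {k : ℕ} (τ : Equiv.Perm (Fin k)) (a b : Fin k) : Prop :=
  τ.symm a < τ.symm b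

/-- Uniform probability of an event over a finite type. -/
noncomputable def prob {Ω : Type*} [Fintype Ω] (p : Ω → Prop) : ℝ := by
  classical exact ((Finset.univ.filter p).card : ℝ) / (Fintype.card Ω : ℝ)

/-- `τ` and `τ'` agree outside a block of at most `r` consecutive positions. -/
def AgreeOutsideBlock {k : ℕ} (r : ℕ) (τ τ' : Equiv.Perm (Fin k)) : Prop :=
  ∃ l : ℕ, ∀ p : Fin k, ((p : ℕ) < l ∨ l + r ≤ (p : ℕ)) → τ p = τ' p

/-- `σ` is a manipulation point of the one-voter SCF `f`. -/
def IsMPoint1 {k : ℕ} (f : Equiv.Perm (Fin k) → Fin k) (σ : Equiv.Perm (Fin k)) : Prop :=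
  ∃ σ', σ ≠ σ' ∧ Above σ (f σ') (f σ)

/-- `σ` is an `r`-manipulation point of the one-voter SCF `f`, i.e. `σ ∈ M_r(f)`. -/
def IsMPointR1 {k : ℕ} (r : ℕ) (f : Equiv.Perm (Fin k) → Fin k)
    (σ : Equiv.Perm (Fin k)) : Prop :=
  ∃ σ', σ ≠ σ' ∧ Above σ (f σ') (f σ) ∧ AgreeOutsideBlock r σ σ'

/-- `f = top_H`: `f` always elects the top alternative among `H`. -/
def IsTop1 {k : ℕ} (f : Equiv.Perm (Fin k) → Fin k) (H : Finset (Fin k)) : Prop :=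
  ∀ σ, f σ ∈ H ∧ ∀ b ∈ H, b ≠ f σ → Above σ (f σ) b

/-- `f` takes exactly two values. -/
def TakesExactlyTwoValues1 {k : ℕ} (f : Equiv.Perm (Fin k) → Fin k) : Prop :=
  ∃ a b : Fin k, a ≠ b ∧ (∀ σ, f σ = a ∨ f σ = b) ∧ (∃ σ, f σ = a) ∧ (∃ σ, f σ = b)

/-- `f` is monotone (one-voter version). -/
def IsMonotone1 {k : ℕ} (f : Equiv.Perm (Fin k) → Fin k) : Prop :=
  ∀ σ σ', f σ ≠ f σ' → Above σ' (f σ') (f σ)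

/-- The family `NONMANIP(1,k)` of nonmanipulable one-voter social choice functions. -/
def InNonManip1 {k : ℕ} (f : Equiv.Perm (Fin k) → Fin k) : Prop :=
  (∃ H : Finset (Fin k), H.Nonempty ∧ IsTop1 f H) ∨
  (TakesExactlyTwoValues1 f ∧ IsMonotone1 f)

/-- `[a:b]σ`: swap `a` and `b` in `σ` if they occupy adjacent positions,
and `σ` otherwise. -/
def adjSwap {k : ℕ} (a b : Fin k) (σ : Equiv.Perm (Fin k)) : Equiv.Perm (Fin k) :=
  if (σ.symm a : ℕ) + 1 = (σ.symm b : ℕ) ∨ (σ.symm b : ℕ) + 1 = (σ.symm a : ℕ)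
  then Equiv.swap a b * σ else σ

/-- `σ ∈ F̄`: `a` occupies the position directly above `b` in `σ`. -/
def Fbar {k : ℕ} (a b : Fin k) (σ : Equiv.Perm (Fin k)) : Prop :=
  (σ.symm a : ℕ) + 1 = (σ.symm b : ℕ)

/-- `σ ∈ B`: `f σ = a`, `f([a:b]σ) = b` and `a` is above `b` in `σ`. -/
def BSet {k : ℕ} (f : Equiv.Perm (Fin k) → Fin k) (a b : Fin k)
    (σ : Equiv.Perm (Fin k)) : Prop :=
  f σ = a ∧ f (adjSwap a b σ) = b ∧ Above σ a b

/-- Adjacency in the graph `G` on `F̄`: transposing two elements in adjacent positions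
when the adjacent pair `a,b` is treated as a single block element (either swapping two
elements neither of which is `a` or `b`, or moving the `a,b`-block up or down by one). -/
def GAdj {k : ℕ} (a b : Fin k) (σ π : Equiv.Perm (Fin k)) : Prop :=
  Fbar a b σ ∧ Fbar a b π ∧
    ((∃ p q : Fin k, (p : ℕ) + 1 = (q : ℕ) ∧ σ p ≠ a ∧ σ p ≠ b ∧ σ q ≠ a ∧ σ q ≠ b ∧
        π = σ * Equiv.swap p q) ∨
     (∃ p q r : Fin k, (p : ℕ) + 1 = (q : ℕ) ∧ (q : ℕ) + 1 = (r : ℕ) ∧ σ q = a ∧ σ r = b ∧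
        π = σ * (Equiv.swap p r * Equiv.swap p q)) ∨
     (∃ p q r : Fin k, (p : ℕ) + 1 = (q : ℕ) ∧ (q : ℕ) + 1 = (r : ℕ) ∧ σ p = a ∧ σ q = b ∧
        π = σ * (Equiv.swap p q * Equiv.swap p r)))

/-- `σ ∈ ∂(B)`: `σ ∈ B` and `σ` has a `G`-neighbor in `F̄ ∖ B`. -/
def InBdryB {k : ℕ} (f : Equiv.Perm (Fin k) → Fin k) (a b : Fin k)
    (σ : Equiv.Perm (Fin k)) : Prop :=
  BSet f a b σ ∧ ∃ π, GAdj a b σ π ∧ ¬ BSet f a b π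

/-- `σ ∈ LD^H`: `σ` is a local dictator on `H`: the alternatives of `H` occupy a block
of consecutive positions in `σ`, and for every `σ'` obtained from `σ` by permuting the
alternatives of `H` within this block, `f σ'` is the top-ranked alternative of `H` in `σ'`. -/
def IsLocalDict {k : ℕ} (f : Equiv.Perm (Fin k) → Fin k) (H : Finset (Fin k))
    (σ : Equiv.Perm (Fin k)) : Prop :=
  (∃ l : ℕ, ∀ x : Fin k, σ x ∈ H ↔ l ≤ (x : ℕ) ∧ (x : ℕ) < l + H.card) ∧
  ∀ σ' : Equiv.Perm (Fin k), (∀ x, σ x ∉ H → σ' x = σ x) →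
    f σ' ∈ H ∧ ∀ c ∈ H, c ≠ f σ' → Above σ' (f σ') c

/-- `σ ∈ LD(a,b) = ∪_{c ∉ {a,b}} LD^{{a,b,c}}`. -/
def InLD {k : ℕ} (f : Equiv.Perm (Fin k) → Fin k) (a b : Fin k)
    (σ : Equiv.Perm (Fin k)) : Prop :=
  ∃ c, c ≠ a ∧ c ≠ b ∧ IsLocalDict f ({a, b, c} : Finset (Fin k)) σ

/-- `τ'` is obtained from `τ` by moving only the alternative `c` (the relative order of
all other alternatives is unchanged). -/
def MovedOnly {k : ℕ} (c : Fin k) (τ τ' : Equiv.Perm (Fin k)) : Prop :=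
  ∀ x y, x ≠ c → y ≠ c → (Above τ x y ↔ Above τ' x y)

/-- `σ ∈ V_{(a,b,c)}`: the top three positions of `σ` hold `a`, `b`, `c` in this order. -/
def VSet {k : ℕ} (a b c : Fin k) (σ : Equiv.Perm (Fin k)) : Prop :=
  ∃ p q r : Fin k, (p : ℕ) = 0 ∧ (q : ℕ) = 1 ∧ (r : ℕ) = 2 ∧ σ p = a ∧ σ q = b ∧ σ r = c

/-- Adjacency in the graph `G_{(a,b,c)}`: both in `V_{(a,b,c)}` and differing by
transposing the alternatives in two adjacent positions. -/
def VAdj {k : ℕ} (a b c : Fin k) (σ π : Equiv.Perm (Fin k)) : Prop :=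
  VSet a b c σ ∧ VSet a b c π ∧ σ ≠ π ∧
    ∃ p q : Fin k, (p : ℕ) + 1 = (q : ℕ) ∧ π = σ * Equiv.swap p q

/-- `σ ∈ T(a,b,c) = V_{(a,b,c)} ∩ LD^{{a,b,c}}`. -/
def TSet {k : ℕ} (f : Equiv.Perm (Fin k) → Fin k) (a b c : Fin k)
    (σ : Equiv.Perm (Fin k)) : Prop :=
  VSet a b c σ ∧ IsLocalDict f ({a, b, c} : Finset (Fin k)) σ

/-- `σ ∈ ∂(T(a,b,c))`. -/
def InBdryT {k : ℕ} (f : Equiv.Perm (Fin k) → Fin k) (a b c : Fin k)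
    (σ : Equiv.Perm (Fin k)) : Prop :=
  TSet f a b c σ ∧ ∃ π, VAdj a b c σ π ∧ ¬ TSet f a b c π

theorem Above.asymm' {k : ℕ} {τ : Equiv.Perm (Fin k)} {x y : Fin k} (h : Above τ x y) :
    ¬ Above τ y x := by
  unfold Above at *; exact not_lt_of_gt h

theorem above_total {k : ℕ} (τ : Equiv.Perm (Fin k)) {x y : Fin k} (h : x ≠ y) :
    Above τ x y ∨ Above τ y x := by
  unfold Above
  exact lt_or_gt_of_ne (fun e => h (τ.symm.injective e))

/-- Relative order under an adjacent transposition. -/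
theorem above_swap {k : ℕ} (σ : Equiv.Perm (Fin k)) (p q : Fin k) (hpq : (p : ℕ) + 1 = q)
    (x y : Fin k) (hx : ¬ (x = σ p ∧ y = σ q)) (hy : ¬ (x = σ q ∧ y = σ p)) :
    Above σ x y ↔ Above (σ * Equiv.swap p q) x y := by
  obtain ⟨i, rfl⟩ := σ.surjective x
  obtain ⟨j, rfl⟩ := σ.surjective y
  have key : ∀ i, (σ * Equiv.swap p q).symm (σ i) = Equiv.swap p q i := by
    intro i
    rw [Equiv.symm_apply_eq]
    simp
  unfold Above
  rw [key, key]
  simp only [Equiv.symm_apply_apply, EmbeddingLike.apply_eq_iff_eq] at *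
  simp only [Equiv.swap_apply_def, Fin.lt_def, Fin.ext_iff] at *
  split_ifs <;> omega

theorem movedOnly_swap {k : ℕ} (σ : Equiv.Perm (Fin k)) (p q : Fin k) (hpq : (p : ℕ) + 1 = q) :
    MovedOnly (σ p) σ (σ * Equiv.swap p q) := by
  intro x y hx hy
  exact above_swap σ p q hpq x y (fun h => hx h.1) (fun h => hy h.2)

theorem swap_ne {k : ℕ} (σ : Equiv.Perm (Fin k)) (p q : Fin k) (hpq : (p : ℕ) + 1 = q) :
    σ ≠ σ * Equiv.swap p q := by
  intro h
  have := congrArg (fun e => e p) h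
  simp [Fin.ext_iff] at this
  omega

theorem swap_manip {k : ℕ} (f : Equiv.Perm (Fin k) → Fin k) (σ : Equiv.Perm (Fin k))
    (p q : Fin k) (hpq : (p : ℕ) + 1 = q) (h1 : f σ ≠ σ p) (h2 : f σ ≠ σ q)
    (hne : f (σ * Equiv.swap p q) ≠ f σ) :
    ∃ σh, IsMPointR1 3 f σh ∧ MovedOnly (σ p) σ σh := by
  have hag : ∀ x : Fin k, ((x : ℕ) < p ∨ (p : ℕ) + 3 ≤ x) → σ x = (σ * Equiv.swap p q) x := by
    intro x hx
    have h1 : x ≠ p := by rintro rfl; omega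
    have h2 : x ≠ q := by rintro rfl; omega
    simp [Equiv.swap_apply_of_ne_of_ne h1 h2]
  rcases above_total σ hne with h | h
  · exact ⟨σ, ⟨_, swap_ne σ p q hpq, h, p, hag⟩, fun x y _ _ => Iff.rfl⟩
  · refine ⟨_, ⟨σ, (swap_ne σ p q hpq).symm, ?_, p, fun x hx => (hag x hx).symm⟩,
      movedOnly_swap σ p q hpq⟩
    exact (above_swap σ p q hpq _ _ (fun h => h1 h.1) (fun h => h2 h.1)).1 h

theorem adjSwap_of_Fbar {k : ℕ} {a b : Fin k} {σ : Equiv.Perm (Fin k)} (h : Fbar a b σ) :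
    adjSwap a b σ = Equiv.swap a b * σ := by
  unfold adjSwap
  exact if_pos (Or.inl h)

theorem above_of_Fbar {k : ℕ} {a b : Fin k} {σ : Equiv.Perm (Fin k)} (h : Fbar a b σ) :
    Above σ a b := by
  unfold Fbar at h
  unfold Above
  rw [Fin.lt_def]; omega

theorem above_adjSwap {k : ℕ} {a b : Fin k} {σ : Equiv.Perm (Fin k)} (h : Fbar a b σ) :
    Above (adjSwap a b σ) b a := by
  rw [adjSwap_of_Fbar h]
  have h' := above_of_Fbar h
  unfold Above at *
  have key : ∀ x, (Equiv.swap a b * σ).symm x = σ.symm (Equiv.swap a b x) := by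
    intro x
    rw [Equiv.symm_apply_eq]; simp
  rw [key, key]; simpa using h'

theorem block_symm_out {k : ℕ} {σ τ : Equiv.Perm (Fin k)} {H : Finset (Fin k)}
    (h : ∀ x, σ x ∉ H → τ x = σ x) {x : Fin k} (hx : x ∉ H) : τ.symm x = σ.symm x := by
  rw [Equiv.symm_apply_eq, h]
  · simp
  · simpa using hx

theorem block_symm_in {k : ℕ} {σ τ : Equiv.Perm (Fin k)} {H : Finset (Fin k)}
    (h : ∀ x, σ x ∉ H → τ x = σ x) {x : Fin k} (hx : x ∈ H) : σ (τ.symm x) ∈ H := by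
  by_contra hc
  have := h _ hc
  rw [Equiv.apply_symm_apply] at this
  exact hc (this ▸ hx)

/-- Order of two alternatives not both in the block is the same. -/
theorem block_above {k : ℕ} {σ τ τ' : Equiv.Perm (Fin k)} {H : Finset (Fin k)} {l m : ℕ}
    (hl : ∀ x : Fin k, σ x ∈ H ↔ l ≤ (x : ℕ) ∧ (x : ℕ) < l + m)
    (h : ∀ x, σ x ∉ H → τ x = σ x) (h' : ∀ x, σ x ∉ H → τ' x = σ x)
    {x y : Fin k} (hxy : ¬ (x ∈ H ∧ y ∈ H)) : Above τ x y ↔ Above τ' x y := by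
  unfold Above
  have hin := fun z (hz : z ∈ H) => (hl _).1 (block_symm_in h hz)
  have hin' := fun z (hz : z ∈ H) => (hl _).1 (block_symm_in h' hz)
  have hout : ∀ z, z ∉ H → ¬ (l ≤ ((σ.symm z : Fin k) : ℕ) ∧ ((σ.symm z : Fin k) : ℕ) < l + m) := by
    intro z hz
    rw [← hl]; simpa using hz
  by_cases hx : x ∈ H
  · have hy : y ∉ H := fun hy => hxy ⟨hx, hy⟩
    have e1 := hin x hx
    have e2 := hin' x hx
    have e3 := hout y hy
    rw [block_symm_out h hy, block_symm_out h' hy, Fin.lt_def, Fin.lt_def]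
    omega
  · have e3 := hout x hx
    rw [block_symm_out h hx, block_symm_out h' hx]
    by_cases hy : y ∈ H
    · have e1 := hin y hy
      have e2 := hin' y hy
      rw [Fin.lt_def, Fin.lt_def]
      omega
    · rw [block_symm_out h hy, block_symm_out h' hy]

theorem block_moved {k : ℕ} {σ τ τ' : Equiv.Perm (Fin k)} {a b c : Fin k} {l m : ℕ}
    (hl : ∀ x : Fin k, σ x ∈ ({a, b, c} : Finset (Fin k)) ↔ l ≤ (x : ℕ) ∧ (x : ℕ) < l + m)
    (h : ∀ x, σ x ∉ ({a, b, c} : Finset (Fin k)) → τ x = σ x)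
    (h' : ∀ x, σ x ∉ ({a, b, c} : Finset (Fin k)) → τ' x = σ x)
    (h1 : Above τ a b ↔ Above τ' a b) (h2 : Above τ b a ↔ Above τ' b a) :
    MovedOnly c τ τ' := by
  intro x y hx hy
  by_cases hxy : x ∈ ({a, b, c} : Finset (Fin k)) ∧ y ∈ ({a, b, c} : Finset (Fin k))
  · simp only [Finset.mem_insert, Finset.mem_singleton, hx, hy, or_false] at hxy
    obtain ⟨rfl | rfl, rfl | rfl⟩ := hxy
    · simp [Above]
    · exact h1
    · exact h2
    · simp [Above]
  · exact block_above hl h h' hxy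

theorem block_adjSwap {k : ℕ} {σ τ : Equiv.Perm (Fin k)} {a b : Fin k} {H : Finset (Fin k)}
    (ha : a ∈ H) (hb : b ∈ H) (h : ∀ x, σ x ∉ H → τ x = σ x) (hF : Fbar a b τ) :
    ∀ x, σ x ∉ H → adjSwap a b τ x = σ x := by
  intro x hx
  rw [adjSwap_of_Fbar hF, Equiv.Perm.mul_apply, h x hx]
  apply Equiv.swap_apply_of_ne_of_ne
  · rintro rfl; exact hx ha
  · rintro rfl; exact hx hb

theorem block_case {k : ℕ} (a b c : Fin k) (hab : a ≠ b) (hca : c ≠ a) (hcb : c ≠ b)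
    (f : Equiv.Perm (Fin k) → Fin k) (σ π : Equiv.Perm (Fin k)) (l : ℕ)
    (hl : ∀ x : Fin k, σ x ∈ ({a, b, c} : Finset (Fin k)) ↔ l ≤ (x : ℕ) ∧ (x : ℕ) < l + 3)
    (hF : Fbar a b σ) (hB : BSet f a b σ) (hFπ : Fbar a b π) (hBπ : ¬ BSet f a b π)
    (hπ : ∀ x, σ x ∉ ({a, b, c} : Finset (Fin k)) → π x = σ x) :
    InLD f a b σ ∨
      ∃ (c : Fin k) (σh : Equiv.Perm (Fin k)), c ≠ a ∧ c ≠ b ∧ IsMPointR1 3 f σh ∧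
        (MovedOnly c σ σh ∨ MovedOnly c (adjSwap a b σ) σh) := by
  by_cases hM : ∃ τ : Equiv.Perm (Fin k),
      (∀ x, σ x ∉ ({a, b, c} : Finset (Fin k)) → τ x = σ x) ∧ IsMPointR1 3 f τ
  · right
    obtain ⟨τ, hτ, hm⟩ := hM
    refine ⟨c, τ, hca, hcb, hm, ?_⟩
    rcases above_total τ hab with h | h
    · left
      have hs := above_of_Fbar hF
      exact block_moved hl (fun _ _ => rfl) hτ (iff_of_true hs h)
        (iff_of_false hs.asymm' h.asymm')
    · right
      have hs := above_adjSwap hF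
      exact block_moved hl (block_adjSwap (by simp) (by simp) (fun _ _ => rfl) hF) hτ
        (iff_of_false hs.asymm' h.asymm') (iff_of_true hs h)
  · left
    have hno : ∀ τ τ' : Equiv.Perm (Fin k),
        (∀ x, σ x ∉ ({a, b, c} : Finset (Fin k)) → τ x = σ x) →
        (∀ x, σ x ∉ ({a, b, c} : Finset (Fin k)) → τ' x = σ x) → ¬ Above τ (f τ') (f τ) := by
      intro τ τ' h h' hA
      refine hM ⟨τ, h, τ', ?_, hA, l, ?_⟩
      · rintro rfl
        exact lt_irrefl _ hA
      · intro x hx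
        have : σ x ∉ ({a, b, c} : Finset (Fin k)) := by
          rw [hl]; omega
        rw [h x this, h' x this]
    have hσ : ∀ x, σ x ∉ ({a, b, c} : Finset (Fin k)) → σ x = σ x := fun _ _ => rfl
    have hσ' := block_adjSwap (σ := σ) (τ := σ) (a := a) (b := b)
      (H := {a, b, c}) (by simp) (by simp) hσ hF
    have hπ' := block_adjSwap (σ := σ) (τ := π) (a := a) (b := b)
      (H := {a, b, c}) (by simp) (by simp) hπ hFπ
    obtain ⟨hfa, hfb, -⟩ := hB
    have hrange : ∀ τ : Equiv.Perm (Fin k),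
        (∀ x, σ x ∉ ({a, b, c} : Finset (Fin k)) → τ x = σ x) →
        f τ ∈ ({a, b, c} : Finset (Fin k)) := by
      intro τ hτ
      by_contra hx
      have hne : f τ ≠ a := by
        intro h; apply hx; simp [h]
      have e1 := hno τ σ hτ hσ
      have e2 := hno σ τ hσ hτ
      rw [hfa] at e1 e2
      have := block_above (x := f τ) (y := a) hl hσ hτ (fun h => hx h.1)
      rcases above_total τ hne with h | h
      · exact e2 (this.2 h)
      · exact e1 h
    by_cases hc : ∃ τ : Equiv.Perm (Fin k),
        (∀ x, σ x ∉ ({a, b, c} : Finset (Fin k)) → τ x = σ x) ∧ f τ = c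
    · obtain ⟨τc, hτc, hfc⟩ := hc
      refine ⟨c, hca, hcb, ⟨l, ?_⟩, ?_⟩
      · have : ({a, b, c} : Finset (Fin k)).card = 3 :=
          Finset.card_eq_three.2 ⟨a, b, c, hab, hca.symm, hcb.symm, rfl⟩
        rw [this]; exact hl
      · intro τ hτ
        refine ⟨hrange τ hτ, ?_⟩
        intro d hd hdne
        rcases above_total τ hdne with h | h
        · exfalso
          simp only [Finset.mem_insert, Finset.mem_singleton] at hd
          rcases hd with rfl | rfl | rfl
          · exact hno τ σ hτ hσ (by rwa [hfa])
          · exact hno τ _ hτ hσ' (by rwa [hfb])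
          · exact hno τ τc hτ hτc (by rwa [hfc])
        · exact h
    · exfalso
      have hr2 : ∀ τ : Equiv.Perm (Fin k),
          (∀ x, σ x ∉ ({a, b, c} : Finset (Fin k)) → τ x = σ x) → f τ = a ∨ f τ = b := by
        intro τ hτ
        have h1 := hrange τ hτ
        have h2 : f τ ≠ c := fun h => hc ⟨τ, hτ, h⟩
        simpa [h2] using h1
      apply hBπ
      refine ⟨?_, ?_, above_of_Fbar hFπ⟩
      · refine (hr2 π hπ).resolve_right fun h => hno π σ hπ hσ ?_
        rw [h, hfa]; exact above_of_Fbar hFπ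
      · refine (hr2 _ hπ').resolve_left fun h => hno _ _ hπ' hσ' ?_
        rw [h, hfb]; exact above_adjSwap hFπ

theorem stmt13 (k : ℕ) (hk : 3 ≤ k) (a b : Fin k) (hab : a ≠ b)
    (f : Equiv.Perm (Fin k) → Fin k) (σ : Equiv.Perm (Fin k))
    (hσ : InBdryB f a b σ) :
    InLD f a b σ ∨
      ∃ (c : Fin k) (σh : Equiv.Perm (Fin k)), c ≠ a ∧ c ≠ b ∧ IsMPointR1 3 f σh ∧
        (MovedOnly c σ σh ∨ MovedOnly c (adjSwap a b σ) σh) := by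
  obtain ⟨hB, π, ⟨hF, hFπ, hadj⟩, hBπ⟩ := hσ
  rcases hadj with ⟨p, q, hpq, hpa, hpb, hqa, hqb, rfl⟩ | ⟨p, q, r, hpq, hqr, hqa, hrb, rfl⟩ |
    ⟨p, q, r, hpq, hqr, hpa, hqb, rfl⟩
  · right
    by_cases h1 : f (σ * Equiv.swap p q) = a
    · have hs := adjSwap_of_Fbar hF
      have hp : (adjSwap a b σ) p = σ p := by
        rw [hs]; exact Equiv.swap_apply_of_ne_of_ne hpa hpb
      have hq : (adjSwap a b σ) q = σ q := by
        rw [hs]; exact Equiv.swap_apply_of_ne_of_ne hqa hqb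
      have h2 : f (adjSwap a b σ * Equiv.swap p q) ≠ b := by
        intro h
        refine hBπ ⟨h1, ?_, above_of_Fbar hFπ⟩
        rw [adjSwap_of_Fbar hFπ, ← mul_assoc, ← hs]; exact h
      obtain ⟨σh, hm, hmv⟩ := swap_manip f (adjSwap a b σ) p q hpq
        (by rw [hB.2.1, hp]; exact hpb.symm) (by rw [hB.2.1, hq]; exact hqb.symm)
        (by rw [hB.2.1]; exact h2)
      exact ⟨σ p, σh, hpa, hpb, hm, Or.inr (hp ▸ hmv)⟩
    · obtain ⟨σh, hm, hmv⟩ := swap_manip f σ p q hpq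
        (by rw [hB.1]; exact hpa.symm) (by rw [hB.1]; exact hqa.symm)
        (by rw [hB.1]; exact h1)
      exact ⟨σ p, σh, hpa, hpb, hm, Or.inl hmv⟩
  · have hpq' : p ≠ q := by rintro rfl; omega
    have hpr' : p ≠ r := by rintro rfl; omega
    subst hqa hrb
    have hmem : ∀ x, σ x ∈ ({σ q, σ r, σ p} : Finset (Fin k)) ↔ x = q ∨ x = r ∨ x = p := by
      intro x; simp
    refine block_case (σ q) (σ r) (σ p) hab (by simpa using hpq') (by simpa using hpr') f σ _ p
      ?_ hF hB hFπ hBπ ?_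
    · intro x
      rw [hmem]; simp only [Fin.ext_iff]; omega
    · intro x hx
      rw [hmem] at hx
      push Not at hx
      simp [Equiv.swap_apply_of_ne_of_ne hx.2.2 hx.1, Equiv.swap_apply_of_ne_of_ne hx.2.2 hx.2.1]
  · have hpr' : r ≠ p := by rintro rfl; omega
    have hqr' : r ≠ q := by rintro rfl; omega
    subst hpa hqb
    have hmem : ∀ x, σ x ∈ ({σ p, σ q, σ r} : Finset (Fin k)) ↔ x = p ∨ x = q ∨ x = r := by
      intro x; simp
    refine block_case (σ p) (σ q) (σ r) hab (by simpa using hpr') (by simpa using hqr') f σ _ p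
      ?_ hF hB hFπ hBπ ?_
    · intro x
      rw [hmem]; simp only [Fin.ext_iff]; omega
    · intro x hx
      rw [hmem] at hx
      push Not at hx
      simp [Equiv.swap_apply_of_ne_of_ne hx.1 hx.2.2, Equiv.swap_apply_of_ne_of_ne hx.1 hx.2.1]
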